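/- Assume the coercivity condition (C) and that B = (b_{ij}) is a constant monotone irreducible real m×m matrix, where B is irreducible if for every nonempty subset I of 𝕀 with I ≠ 𝕀 there exist i ∈ I and j ∈ 𝕀∖I such that b_{ij} ≠ 0. Then there exist c = (c_i)_{i∈𝕀} ∈ ℝᵐ and v = (v_i)_{i∈𝕀} with each v_i Lipschitz continuous on 𝕋ⁿ such that v is a viscosity solution of Bv + H[v] = c in 𝕋ⁿ. -/

import Mathlib

open MeasureTheory Filter Topology RealInnerProductSpace

noncomputable section

/-- Euclidean space ℝⁿ, the universal cover of the flat torus 𝕋ⁿ = ℝⁿ/ℤⁿ. -/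
abbrev Euc (n : ℕ) := EuclideanSpace ℝ (Fin n)

/-- A vector of ℝⁿ with integer coordinates (an element of ℤⁿ). -/
def IsIntVec {n : ℕ} (z : Euc n) : Prop := ∀ i, ∃ k : ℤ, z i = (k : ℝ)

/-- ℤⁿ-periodic functions on ℝⁿ: these represent functions on the torus 𝕋ⁿ. -/
def TorusFun {n : ℕ} {α : Type*} (f : Euc n → α) : Prop :=
  ∀ (x z : Euc n), IsIntVec z → f (x + z) = f x

/-- Functions on 𝕋ⁿ × Ξ, i.e. ℤⁿ-periodic in the first variable. -/
def TorusFun2 {n : ℕ} {Ξ : Type*} {α : Type*} (f : Euc n × Ξ → α) : Prop :=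
  ∀ (x z : Euc n) (ξ : Ξ), IsIntVec z → f (x + z, ξ) = f (x, ξ)

/-- The Hamiltonian H_{φ,i}(x,p) = sup_{ξ∈Ξ} (−g_i(x,ξ)·p − φ_i(x,ξ)). -/
def ham {n m : ℕ} {Ξ : Type*} (g : Fin m → Euc n × Ξ → Euc n)
    (φ : Fin m → Euc n × Ξ → ℝ) (i : Fin m) (x p : Euc n) : ℝ :=
  ⨆ ξ : Ξ, (-⟪g i (x, ξ), p⟫ - φ i (x, ξ))

/-- The data g = (g_i), L = (L_i) consist of continuous functions on 𝕋ⁿ × Ξ. -/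
def GoodData {n m : ℕ} {Ξ : Type*} [TopologicalSpace Ξ]
    (g : Fin m → Euc n × Ξ → Euc n) (L : Fin m → Euc n × Ξ → ℝ) : Prop :=
  (∀ i, Continuous (g i) ∧ TorusFun2 (g i)) ∧ (∀ i, Continuous (L i) ∧ TorusFun2 (L i))

/-- Coercivity (C): min_{x∈𝕋ⁿ} H_i(x,p) → ∞ as |p| → ∞. -/
def Coercive {n m : ℕ} {Ξ : Type*} (g : Fin m → Euc n × Ξ → Euc n)
    (L : Fin m → Euc n × Ξ → ℝ) : Prop :=
  ∀ (i : Fin m) (M : ℝ), ∃ R : ℝ, ∀ p : Euc n, R ≤ ‖p‖ → ∀ x : Euc n, M ≤ ham g L i x p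

/-- A monotone m×m real matrix. -/
def IsMonotoneMat {m : ℕ} (B : Matrix (Fin m) (Fin m) ℝ) : Prop :=
  ∀ (u : Fin m → ℝ) (k : Fin m), (∀ i, u i ≤ u k) → 0 ≤ u k → 0 ≤ ∑ j, B k j * u j

/-- Assumption (M): B(x) has continuous entries (as functions on 𝕋ⁿ) and is monotone
for every x. -/
def GoodCoupling {n m : ℕ} (B : Euc n → Matrix (Fin m) (Fin m) ℝ) : Prop :=
  (∀ i j, Continuous (fun x => B x i j) ∧ TorusFun (fun x => B x i j)) ∧
    ∀ x, IsMonotoneMat (B x)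

/-- Viscosity subsolution of λu + Bu + H_φ[u] = c in 𝕋ⁿ. -/
def IsSubsol {n m : ℕ} {Ξ : Type*} (B : Euc n → Matrix (Fin m) (Fin m) ℝ) (lam : ℝ)
    (g : Fin m → Euc n × Ξ → Euc n) (φ : Fin m → Euc n × Ξ → ℝ)
    (c : Fin m → ℝ) (u : Fin m → Euc n → ℝ) : Prop :=
  (∀ i, UpperSemicontinuous (u i) ∧ TorusFun (u i)) ∧
    ∀ (i : Fin m) (ψ : Euc n → ℝ), ContDiff ℝ 1 ψ → TorusFun ψ →
      ∀ x : Euc n, IsLocalMax (fun y => u i y - ψ y) x →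
        lam * u i x + (∑ j, B x i j * u j x) + ham g φ i x (gradient ψ x) ≤ c i

/-- Viscosity supersolution of λu + Bu + H_φ[u] = c in 𝕋ⁿ. -/
def IsSupersol {n m : ℕ} {Ξ : Type*} (B : Euc n → Matrix (Fin m) (Fin m) ℝ) (lam : ℝ)
    (g : Fin m → Euc n × Ξ → Euc n) (φ : Fin m → Euc n × Ξ → ℝ)
    (c : Fin m → ℝ) (u : Fin m → Euc n → ℝ) : Prop :=
  (∀ i, LowerSemicontinuous (u i) ∧ TorusFun (u i)) ∧
    ∀ (i : Fin m) (ψ : Euc n → ℝ), ContDiff ℝ 1 ψ → TorusFun ψ →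
      ∀ x : Euc n, IsLocalMin (fun y => u i y - ψ y) x →
        c i ≤ lam * u i x + (∑ j, B x i j * u j x) + ham g φ i x (gradient ψ x)

/-- Viscosity solution of λu + Bu + H_φ[u] = c in 𝕋ⁿ. -/
def IsSol {n m : ℕ} {Ξ : Type*} (B : Euc n → Matrix (Fin m) (Fin m) ℝ) (lam : ℝ)
    (g : Fin m → Euc n × Ξ → Euc n) (φ : Fin m → Euc n × Ξ → ℝ)
    (c : Fin m → ℝ) (u : Fin m → Euc n → ℝ) : Prop :=
  (∀ i, Continuous (u i)) ∧ IsSubsol B lam g φ c u ∧ IsSupersol B lam g φ c u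

/-- (φ,u) ∈ F(λ): φ ∈ C(𝕋ⁿ×Ξ)ᵐ, u ∈ C(𝕋ⁿ)ᵐ and u is a viscosity subsolution of
B^λ u + H_φ[u] = 0 in 𝕋ⁿ. -/
def memF {n m : ℕ} {Ξ : Type*} [TopologicalSpace Ξ]
    (B : Euc n → Matrix (Fin m) (Fin m) ℝ) (lam : ℝ)
    (g : Fin m → Euc n × Ξ → Euc n)
    (φ : Fin m → Euc n × Ξ → ℝ) (u : Fin m → Euc n → ℝ) : Prop :=
  (∀ i, Continuous (φ i) ∧ TorusFun2 (φ i)) ∧ (∀ i, Continuous (u i)) ∧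
    IsSubsol B lam g φ (fun _ => 0) u

/-- ρ_i(x) = Σ_j b_{ij}(x). -/
def rhoB {n m : ℕ} (B : Euc n → Matrix (Fin m) (Fin m) ℝ) (i : Fin m) (x : Euc n) : ℝ :=
  ∑ j, B x i j

/-- ν ∈ P_{B^λ}: a family of finite nonnegative Borel measures with ⟨ν, B^λ1⟩ = 1. -/
def memPB {n m : ℕ} {Ξ : Type*} [MeasurableSpace Ξ]
    (B : Euc n → Matrix (Fin m) (Fin m) ℝ) (lam : ℝ)
    (ν : Fin m → Measure (Euc n × Ξ)) : Prop :=
  (∀ i, IsFiniteMeasure (ν i)) ∧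
    (∑ i, ∫ q, (lam + rhoB B i q.1) ∂(ν i)) = 1

/-- ν ∈ G'(z,k,λ): ν ∈ P_{B^λ} and ⟨ν, φ − u_k(z) B^λ1⟩ ≥ 0 for every (φ,u) ∈ F(λ). -/
def memGP {n m : ℕ} {Ξ : Type*} [TopologicalSpace Ξ] [MeasurableSpace Ξ]
    (B : Euc n → Matrix (Fin m) (Fin m) ℝ) (lam : ℝ)
    (g : Fin m → Euc n × Ξ → Euc n) (z : Euc n) (k : Fin m)
    (ν : Fin m → Measure (Euc n × Ξ)) : Prop :=
  memPB B lam ν ∧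
    ∀ φ u, memF B lam g φ u →
      0 ≤ ∑ i, ∫ q, (φ i q - u k z * (lam + rhoB B i q.1)) ∂(ν i)

/-- μ ∈ P: a family of nonnegative Borel measures of total mass 1. -/
def memP {n m : ℕ} {Ξ : Type*} [MeasurableSpace Ξ]
    (μ : Fin m → Measure (Euc n × Ξ)) : Prop :=
  (∀ i, IsFiniteMeasure (μ i)) ∧ (∑ i, (μ i Set.univ).toReal) = 1

/-- μ ∈ P(z,k,λ): μ ∈ P and Σ_i ⟨μ_i, (λ+ρ_i)⁻¹ φ_i⟩ ≥ u_k(z) for all (φ,u) ∈ F(λ). -/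
def memPzk {n m : ℕ} {Ξ : Type*} [TopologicalSpace Ξ] [MeasurableSpace Ξ]
    (B : Euc n → Matrix (Fin m) (Fin m) ℝ) (lam : ℝ)
    (g : Fin m → Euc n × Ξ → Euc n) (z : Euc n) (k : Fin m)
    (μ : Fin m → Measure (Euc n × Ξ)) : Prop :=
  memP μ ∧
    ∀ φ u, memF B lam g φ u →
      u k z ≤ ∑ i, ∫ q, (lam + rhoB B i q.1)⁻¹ * φ i q ∂(μ i)

/-- μ ∈ P(0): μ ∈ P and ⟨μ,φ⟩ ≥ 0 for all (φ,u) ∈ F(0). -/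
def memP0 {n m : ℕ} {Ξ : Type*} [TopologicalSpace Ξ] [MeasurableSpace Ξ]
    (B : Euc n → Matrix (Fin m) (Fin m) ℝ)
    (g : Fin m → Euc n × Ξ → Euc n)
    (μ : Fin m → Measure (Euc n × Ξ)) : Prop :=
  memP μ ∧ ∀ φ u, memF B 0 g φ u → 0 ≤ ∑ i, ∫ q, φ i q ∂(μ i)

/-- μ ∈ M₊(0): a family of finite nonnegative Borel measures with ⟨μ,φ⟩ ≥ 0 for all
(φ,u) ∈ F(0). -/
def memM0 {n m : ℕ} {Ξ : Type*} [TopologicalSpace Ξ] [MeasurableSpace Ξ]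
    (B : Euc n → Matrix (Fin m) (Fin m) ℝ)
    (g : Fin m → Euc n × Ξ → Euc n)
    (μ : Fin m → Measure (Euc n × Ξ)) : Prop :=
  (∀ i, IsFiniteMeasure (μ i)) ∧ ∀ φ u, memF B 0 g φ u → 0 ≤ ∑ i, ∫ q, φ i q ∂(μ i)

/-- Assumption (E): problem (P₀) has a Lipschitz continuous viscosity solution. -/
def AssumptionE {n m : ℕ} {Ξ : Type*} (B : Euc n → Matrix (Fin m) (Fin m) ℝ)
    (g : Fin m → Euc n × Ξ → Euc n) (L : Fin m → Euc n × Ξ → ℝ) : Prop :=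
  ∃ v₀ : Fin m → Euc n → ℝ, (∀ i, ∃ K : NNReal, LipschitzWith K (v₀ i)) ∧
    IsSol B 0 g L (fun _ => 0) v₀

end



/-! ### Torus tools -/

/-- The periodic bump `∑ (1 - cos 2π z_k)`. -/
noncomputable def etaF {n : ℕ} (x0 x : Euc n) : ℝ :=
  ∑ k, (1 - Real.cos (2 * Real.pi * (x k - x0 k)))

/-- A periodic function with prescribed gradient at `x0`. -/
noncomputable def sigF {n : ℕ} (x0 p x : Euc n) : ℝ :=
  ∑ k, p k * (Real.sin (2 * Real.pi * (x k - x0 k)) / (2 * Real.pi))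

lemma etaF_per {n : ℕ} (x0 : Euc n) : TorusFun (etaF x0) := by
  intro x z hz
  unfold etaF
  refine Finset.sum_congr rfl fun k _ => ?_
  obtain ⟨a, ha⟩ := hz k
  have : 2 * Real.pi * ((x + z) k - x0 k) = 2 * Real.pi * (x k - x0 k) + a * (2 * Real.pi) := by
    simp only [PiLp.add_apply, ha]; ring
  rw [this, Real.cos_add_int_mul_two_pi]

lemma sigF_per {n : ℕ} (x0 p : Euc n) : TorusFun (sigF x0 p) := by
  intro x z hz
  unfold sigF
  refine Finset.sum_congr rfl fun k _ => ?_
  obtain ⟨a, ha⟩ := hz k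
  have : 2 * Real.pi * ((x + z) k - x0 k) = 2 * Real.pi * (x k - x0 k) + a * (2 * Real.pi) := by
    simp only [PiLp.add_apply, ha]; ring
  rw [this, Real.sin_add_int_mul_two_pi]

lemma etaF_contDiff {n : ℕ} (x0 : Euc n) : ContDiff ℝ 1 (etaF x0) := by
  unfold etaF
  fun_prop

lemma sigF_contDiff {n : ℕ} (x0 p : Euc n) : ContDiff ℝ 1 (sigF x0 p) := by
  unfold sigF
  fun_prop

lemma etaF_nonneg {n : ℕ} (x0 x : Euc n) : 0 ≤ etaF x0 x :=
  Finset.sum_nonneg fun k _ => by linarith [Real.cos_le_one (2 * Real.pi * (x k - x0 k))]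

lemma etaF_self {n : ℕ} (x0 : Euc n) : etaF x0 x0 = 0 := by simp [etaF]

lemma sigF_self {n : ℕ} (x0 p : Euc n) : sigF x0 p x0 = 0 := by simp [sigF]

/-- closed unit cube centred at `x0` -/
def InCube {n : ℕ} (x0 x : Euc n) : Prop := ∀ k, |x k - x0 k| ≤ 1 / 2

lemma etaF_ge {n : ℕ} {x0 x : Euc n} (h : InCube x0 x) : 8 * ‖x - x0‖ ^ 2 ≤ etaF x0 x := by
  rw [EuclideanSpace.norm_sq_eq, Finset.mul_sum]
  unfold etaF
  refine Finset.sum_le_sum fun k _ => ?_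
  have hp := Real.pi_pos
  have h1 : |2 * Real.pi * (x k - x0 k)| ≤ Real.pi := by
    rw [abs_mul, abs_of_pos (by positivity : (0:ℝ) < 2 * Real.pi)]
    have := h k
    nlinarith
  have h3 := Real.cos_le_one_sub_mul_cos_sq h1
  have : 2 / Real.pi ^ 2 * (2 * Real.pi * (x k - x0 k)) ^ 2 = 8 * (x k - x0 k) ^ 2 := by
    field_simp; ring
  simp only [PiLp.sub_apply, Real.norm_eq_abs, sq_abs]
  linarith

lemma exists_shift {n : ℕ} (x0 x : Euc n) : ∃ z : Euc n, IsIntVec z ∧ InCube x0 (x + z) := by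
  refine ⟨WithLp.toLp 2 fun k => -((round (x k - x0 k) : ℤ) : ℝ), fun k => ⟨-round (x k - x0 k), by simp⟩,
    fun k => ?_⟩
  have := abs_sub_round (x k - x0 k)
  have e : (x + WithLp.toLp 2 fun k => -((round (x k - x0 k) : ℤ) : ℝ)) k - x0 k =
      x k - x0 k - round (x k - x0 k) := by
    simp only [PiLp.add_apply]; ring
  rw [e]
  exact this

lemma inCube_norm {n : ℕ} {x0 x : Euc n} (h : InCube x0 x) : ‖x - x0‖ ≤ n := by
  have h0 : ‖x - x0‖ ^ 2 ≤ (n:ℝ) := by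
    rw [EuclideanSpace.norm_sq_eq]
    calc ∑ k, ‖(x - x0) k‖ ^ 2 ≤ ∑ k : Fin n, (1:ℝ) := by
          refine Finset.sum_le_sum fun k _ => ?_
          have := h k
          simp only [PiLp.sub_apply, Real.norm_eq_abs]
          have h0 := abs_nonneg (x k - x0 k)
          nlinarith
      _ = n := by simp
  rcases Nat.eq_zero_or_pos n with h1 | h1
  · subst h1; simp at h0 ⊢; exact Subsingleton.elim _ _
  · have : (1:ℝ) ≤ n := by exact_mod_cast h1
    nlinarith [norm_nonneg (x - x0)]

lemma inCube_self {n : ℕ} (x0 : Euc n) : InCube x0 x0 := fun k => by simp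

lemma isCompact_cube {n : ℕ} (x0 : Euc n) : IsCompact {x | InCube x0 x} := by
  refine (isCompact_closedBall x0 (n:ℝ)).of_isClosed_subset ?_ ?_
  · simp only [InCube, Set.ofPred_forall]
    refine isClosed_iInter fun k => isClosed_le (by fun_prop) continuous_const
  · intro x hx
    rw [mem_closedBall_iff_norm]
    exact inCube_norm hx

lemma per_exists_max {n : ℕ} {f : Euc n → ℝ} (hc : Continuous f) (hp : TorusFun f) (x0 : Euc n) :
    ∃ x, InCube x0 x ∧ ∀ y, f y ≤ f x := by
  obtain ⟨x, hx, hm⟩ := (isCompact_cube x0).exists_isMaxOn ⟨x0, inCube_self x0⟩ hc.continuousOn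
  refine ⟨x, hx, fun y => ?_⟩
  obtain ⟨z, hz, hzc⟩ := exists_shift x0 y
  rw [← hp y z hz]
  exact hm hzc

lemma per_bdd {n : ℕ} {f : Euc n → ℝ} (hc : Continuous f) (hp : TorusFun f) :
    ∃ M, 0 ≤ M ∧ ∀ x, |f x| ≤ M := by
  obtain ⟨x, -, hx⟩ := per_exists_max (f := fun x => |f x|) hc.abs
    (fun x z hz => by simp only [hp x z hz]) 0
  exact ⟨|f x|, abs_nonneg _, hx⟩

lemma grad_eq_of_fderiv {n : ℕ} {f g : Euc n → ℝ} {x y : Euc n} (h : fderiv ℝ f x = fderiv ℝ g y) :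
    gradient f x = gradient g y := by
  simp [gradient, h]

lemma grad_cont {n : ℕ} {f : Euc n → ℝ} (h : ContDiff ℝ 1 f) : Continuous (gradient f) := by
  unfold gradient
  exact (LinearIsometryEquiv.continuous _).comp (h.continuous_fderiv one_ne_zero)

lemma grad_per {n : ℕ} {f : Euc n → ℝ} (h : TorusFun f) : TorusFun (gradient f) := by
  intro x z hz
  apply grad_eq_of_fderiv
  have : f = fun y => f (y + z) := by funext y; exact (h y z hz).symm
  conv_rhs => rw [this]
  rw [fderiv_comp_add_right]

lemma grad_etaF {n : ℕ} (x0 : Euc n) : fderiv ℝ (etaF x0) x0 = 0 := by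
  have : IsLocalMin (etaF x0) x0 := by
    filter_upwards with y
    rw [etaF_self]; exact etaF_nonneg _ _
  exact this.fderiv_eq_zero

lemma grad_sigF {n : ℕ} (x0 p : Euc n) : gradient (sigF x0 p) x0 = p := by
  have h : HasFDerivAt (sigF x0 p) (∑ k, (p k) • (EuclideanSpace.proj k : Euc n →L[ℝ] ℝ)) x0 := by
    unfold sigF
    refine HasFDerivAt.fun_sum fun k _ => ?_
    have h1 : HasFDerivAt (fun x : Euc n => x k) (EuclideanSpace.proj k : Euc n →L[ℝ] ℝ) x0 :=
      (EuclideanSpace.proj k : Euc n →L[ℝ] ℝ).hasFDerivAt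
    have h2 : HasDerivAt (fun t : ℝ => p k * (Real.sin (2 * Real.pi * (t - x0 k)) / (2 * Real.pi)))
        (p k) (x0 k) := by
      have h3 : HasDerivAt (fun t : ℝ => 2 * Real.pi * (t - x0 k)) (2 * Real.pi * 1) (x0 k) :=
        ((hasDerivAt_id _).sub_const _).const_mul _
      have h4 := ((h3.sin).div_const (2 * Real.pi)).const_mul (p k)
      have e : p k * (Real.cos (2 * Real.pi * (x0 k - x0 k)) * (2 * Real.pi * 1) / (2 * Real.pi))
          = p k := by
        have := Real.pi_pos
        rw [sub_self, mul_zero, Real.cos_zero]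
        field_simp
      rw [e] at h4
      exact h4
    exact HasDerivAt.comp_hasFDerivAt (h₂ := fun t : ℝ => p k * (Real.sin (2 * Real.pi * (t - x0 k)) / (2 * Real.pi))) x0 h2 h1
  have h5 : HasGradientAt (sigF x0 p) p x0 := by
    rw [hasGradientAt_iff_hasFDerivAt]
    have e : (InnerProductSpace.toDual ℝ (Euc n)) p =
        ∑ k, (p k) • (EuclideanSpace.proj k : Euc n →L[ℝ] ℝ) := by
      ext v
      simp [PiLp.inner_apply, mul_comm]
    rw [e]
    exact h
  exact h5.gradient

/-- Strict global touching from above, up to periodicity. -/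
def StrictTouch {n : ℕ} (u φ : Euc n → ℝ) (x0 : Euc n) : Prop :=
  ContDiff ℝ 1 φ ∧ TorusFun φ ∧ ∀ x, u x - φ x ≤ u x0 - φ x0 - etaF x0 x

lemma globalize {n : ℕ} {u ψ : Euc n → ℝ} {x0 : Euc n} (hu : Continuous u) (hup : TorusFun u)
    (hψ : ContDiff ℝ 1 ψ) (hψp : TorusFun ψ) (h : IsLocalMax (fun y => u y - ψ y) x0) :
    ∃ φ, StrictTouch u φ x0 ∧ gradient φ x0 = gradient ψ x0 := by
  obtain ⟨r, hr, hball⟩ := Metric.eventually_nhds_iff.1 h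
  set f : Euc n → ℝ := fun y => (u y - ψ y) - (u x0 - ψ x0) with hf
  have hfc : Continuous f := (hu.sub hψ.continuous).sub continuous_const
  have hfp : TorusFun f := fun x z hz => by simp only [hf, hup x z hz, hψp x z hz]
  obtain ⟨M, hM0, hM⟩ := per_bdd hfc hfp
  set C := M / (8 * r ^ 2) with hC
  have hC0 : 0 ≤ C := by positivity
  have key : ∀ x, f x ≤ C * etaF x0 x := by
    intro x
    obtain ⟨z, hz, hzc⟩ := exists_shift x0 x
    rw [← hfp x z hz, ← etaF_per x0 x z hz]
    generalize x + z = y at hzc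
    by_cases hy : dist y x0 < r
    · have := hball hy
      have h2 : 0 ≤ C * etaF x0 y := mul_nonneg hC0 (etaF_nonneg _ _)
      simp only [hf]; linarith
    · push Not at hy
      rw [dist_eq_norm] at hy
      have h1 := etaF_ge hzc
      have h2 : 8 * r ^ 2 ≤ etaF x0 y := by nlinarith
      calc f y ≤ M := (le_abs_self _).trans (hM y)
        _ = C * (8 * r ^ 2) := by rw [hC]; field_simp
        _ ≤ _ := by gcongr
  refine ⟨fun x => ψ x + (C + 1) * etaF x0 x, ⟨?_, ?_, ?_⟩, ?_⟩
  · exact hψ.add (contDiff_const.mul (etaF_contDiff x0))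
  · intro x z hz
    simp only [hψp x z hz, etaF_per x0 x z hz]
  · intro x
    have := key x
    simp only [hf] at this
    simp only [etaF_self]
    linarith
  · apply grad_eq_of_fderiv
    have h1 : DifferentiableAt ℝ ψ x0 := hψ.differentiable one_ne_zero x0
    have h2 : DifferentiableAt ℝ (etaF x0) x0 := (etaF_contDiff x0).differentiable one_ne_zero x0
    rw [fderiv_fun_add h1 (h2.const_mul _), fderiv_const_mul h2, grad_etaF]
    simp

/-- Paraboloid touching from above gives a periodic test function. -/
lemma parab_test {n : ℕ} {u : Euc n → ℝ} {x0 p : Euc n} {a : ℝ}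
    (h : ∀ x, u x ≤ u x0 + ⟪p, x - x0⟫ + a * ‖x - x0‖ ^ 2) :
    ∃ ψ, ContDiff ℝ 1 ψ ∧ TorusFun ψ ∧ gradient ψ x0 = p ∧
      IsLocalMax (fun y => u y - ψ y) x0 := by
  set C := (8 * Real.pi * ‖p‖ + |a|) / 8 with hC
  refine ⟨fun x => sigF x0 p x + C * etaF x0 x, ?_, ?_, ?_, ?_⟩
  · exact (sigF_contDiff x0 p).add (contDiff_const.mul (etaF_contDiff x0))
  · intro x z hz
    simp only [sigF_per x0 p x z hz, etaF_per x0 x z hz]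
  · rw [← grad_sigF x0 p]
    apply grad_eq_of_fderiv
    have h1 : DifferentiableAt ℝ (sigF x0 p) x0 :=
      (sigF_contDiff x0 p).differentiable one_ne_zero x0
    have h2 : DifferentiableAt ℝ (etaF x0) x0 := (etaF_contDiff x0).differentiable one_ne_zero x0
    rw [grad_sigF, fderiv_fun_add h1 (h2.const_mul _), fderiv_const_mul h2, grad_etaF]
    simp
  · have hpi := Real.pi_pos
    have hpi3 := Real.pi_gt_three
    rw [IsLocalMax, IsMaxFilter, Metric.eventually_nhds_iff]
    refine ⟨1 / (2 * Real.pi), by positivity, fun x hx => ?_⟩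
    rw [dist_eq_norm] at hx
    have hcoord : ∀ k, |x k - x0 k| ≤ ‖x - x0‖ := fun k => by
      have := PiLp.norm_apply_le (x - x0) k
      simpa using this
    have hcube : InCube x0 x := fun k => by
      refine (hcoord k).trans (hx.le.trans ?_)
      apply one_div_le_one_div_of_le <;> linarith
    have h1 := etaF_ge hcube
    have hsum : ⟪p, x - x0⟫ - sigF x0 p x ≤ 8 * Real.pi * ‖p‖ * ‖x - x0‖ ^ 2 := by
      rw [EuclideanSpace.norm_sq_eq (x - x0), Finset.mul_sum, PiLp.inner_apply, sigF, ← Finset.sum_sub_distrib]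
      refine Finset.sum_le_sum fun k _ => ?_
      have hs1 : |2 * Real.pi * (x k - x0 k)| ≤ 1 := by
        rw [abs_mul, abs_of_pos (by positivity : (0:ℝ) < 2 * Real.pi)]
        have := (hcoord k).trans hx.le
        rw [le_div_iff₀ (by positivity)] at this
        linarith
      have hpk : |p k| ≤ ‖p‖ := by
        have := PiLp.norm_apply_le p k
        simpa using this
      set t := x k - x0 k with ht
      set s := 2 * Real.pi * t with hs
      have hsb := Real.sin_bound hs1
      have hsa : |s - Real.sin s| ≤ s ^ 2 := by
        have e1 : |s| ^ 3 ≤ |s| ^ 2 := pow_le_pow_of_le_one (abs_nonneg _) hs1 (by norm_num)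
        have e2 : |s| ^ 5 ≤ |s| ^ 2 := pow_le_pow_of_le_one (abs_nonneg _) hs1 (by norm_num)
        have e3 : |s - Real.sin s| ≤ |s| ^ 3 / 6 + |s| ^ 5 / 100 := by
          have : s - Real.sin s = s ^ 3 / 6 - (Real.sin s - (s - s ^ 3 / 6)) := by ring
          rw [this]
          refine (abs_sub _ _).trans ?_
          rw [abs_div, abs_pow]
          norm_num at hsb ⊢
          linarith
        have e4 : |s| ^ 2 = s ^ 2 := sq_abs s
        have e5 : 0 ≤ s ^ 2 := sq_nonneg s
        linarith
      have e6 : inner ℝ (p k) ((x - x0) k) - p k * (Real.sin s / (2 * Real.pi)) =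
          p k * (s - Real.sin s) / (2 * Real.pi) := by
        have : (x - x0) k = t := by simp [ht]
        rw [this, hs]
        simp only [RCLike.inner_apply, conj_trivial]
        field_simp
      rw [e6, div_le_iff₀ (by positivity)]
      have e7 : p k * (s - Real.sin s) ≤ ‖p‖ * s ^ 2 := by
        refine (le_abs_self _).trans ?_
        rw [abs_mul]
        exact mul_le_mul hpk hsa (abs_nonneg _) (norm_nonneg _)
      refine e7.trans ?_
      have e8 : ‖(x - x0) k‖ ^ 2 = t ^ 2 := by simp [ht]
      rw [e8, hs]
      have : 0 ≤ ‖p‖ * t ^ 2 := by positivity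
      nlinarith [mul_nonneg this (by positivity : (0:ℝ) ≤ Real.pi ^ 2)]
    have h2 := h x
    have h3 : a * ‖x - x0‖ ^ 2 ≤ |a| * ‖x - x0‖ ^ 2 :=
      mul_le_mul_of_nonneg_right (le_abs_self a) (sq_nonneg _)
    have h4 : C * (8 * ‖x - x0‖ ^ 2) ≤ C * etaF x0 x :=
      mul_le_mul_of_nonneg_left h1 (by positivity)
    have h5 : C * (8 * ‖x - x0‖ ^ 2) = 8 * Real.pi * ‖p‖ * ‖x - x0‖ ^ 2 + |a| * ‖x - x0‖ ^ 2 := by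
      rw [hC]; ring
    simp only [etaF_self, sigF_self]
    linarith

/-! ### Viscosity sub/supersolutions in abstract form -/

def SubV {n m : ℕ} (A : Matrix (Fin m) (Fin m) ℝ) (H : Fin m → Euc n → Euc n → ℝ)
    (u : Fin m → Euc n → ℝ) : Prop :=
  ∀ (i : Fin m) (ψ : Euc n → ℝ), ContDiff ℝ 1 ψ → TorusFun ψ →
    ∀ x : Euc n, IsLocalMax (fun y => u i y - ψ y) x →
      (∑ j, A i j * u j x) + H i x (gradient ψ x) ≤ 0

def SuperV {n m : ℕ} (A : Matrix (Fin m) (Fin m) ℝ) (H : Fin m → Euc n → Euc n → ℝ)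
    (u : Fin m → Euc n → ℝ) : Prop :=
  ∀ (i : Fin m) (ψ : Euc n → ℝ), ContDiff ℝ 1 ψ → TorusFun ψ →
    ∀ x : Euc n, IsLocalMin (fun y => u i y - ψ y) x →
      0 ≤ (∑ j, A i j * u j x) + H i x (gradient ψ x)

/-- Continuous, periodic and coercive Hamiltonians. -/
structure GoodH {n m : ℕ} (H : Fin m → Euc n → Euc n → ℝ) : Prop where
  cont : ∀ i, Continuous (fun q : Euc n × Euc n => H i q.1 q.2)
  per : ∀ i x z p, IsIntVec z → H i (x + z) p = H i x p
  coer : ∀ i (M : ℝ), ∃ R : ℝ, ∀ p : Euc n, R ≤ ‖p‖ → ∀ x : Euc n, M ≤ H i x p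

lemma ultra_lim {F : Ultrafilter ℕ} {X : Type*} [TopologicalSpace X] {K : Set X} (hK : IsCompact K)
    {x : ℕ → X} (hx : ∀ k, x k ∈ K) : ∃ y ∈ K, Tendsto x F (𝓝 y) := by
  obtain ⟨y, hy, h⟩ := hK.ultrafilter_le_nhds (F.map x)
    (by rw [le_principal_iff]; exact Filter.mem_map.2 (Filter.univ_mem' hx))
  exact ⟨y, hy, h⟩

lemma touch_limit {n : ℕ} (F : Ultrafilter ℕ) {u : ℕ → Euc n → ℝ} {v φ : Euc n → ℝ} {x0 : Euc n}
    (hc : ∀ k, Continuous (u k)) (hp : ∀ k, TorusFun (u k)) (hv : Continuous v)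
    (hφ : StrictTouch v φ x0) (h0 : Tendsto (fun k => u k x0) F (𝓝 (v x0)))
    (hle : ∀ (x : ℕ → Euc n) (y : Euc n), Tendsto x F (𝓝 y) → ∀ ε > 0,
      ∀ᶠ k in (F : Filter ℕ), u k (x k) ≤ v (x k) + ε) :
    ∃ x : ℕ → Euc n, Tendsto x F (𝓝 x0) ∧ (∀ k, IsLocalMax (fun y => u k y - φ y) (x k)) ∧
      Tendsto (fun k => u k (x k)) F (𝓝 (v x0)) := by
  obtain ⟨hφ1, hφp, htouch⟩ := hφ
  have hφc := hφ1.continuous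
  have hex : ∀ k, ∃ x, InCube x0 x ∧ ∀ y, u k y - φ y ≤ u k x - φ x := fun k =>
    per_exists_max (f := fun y => u k y - φ y) ((hc k).sub hφc)
      (fun x z hz => by simp only [hp k x z hz, hφp x z hz]) x0
  choose x hxc hxm using hex
  obtain ⟨y, hyc, hy⟩ := ultra_lim (F := F) (isCompact_cube x0) (x := x) hxc
  have hφy := (hφc.tendsto y).comp hy
  have hvy := (hv.tendsto y).comp hy
  have hy0 : y = x0 := by
    have h1 : v x0 - φ x0 ≤ v y - φ y := by
      refine le_of_forall_pos_le_add fun ε hε => ?_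
      refine le_of_tendsto_of_tendsto (h0.sub_const (φ x0)) ((hvy.sub hφy).add_const ε) ?_
      filter_upwards [hle x y hy ε hε] with k hk
      have := hxm k x0
      simp only [Function.comp]
      linarith
    have h2 := htouch y
    have h3 := etaF_ge hyc
    have h4 : ‖y - x0‖ ^ 2 ≤ 0 := by linarith
    have h5 : ‖y - x0‖ = 0 := by nlinarith [norm_nonneg (y - x0)]
    exact sub_eq_zero.1 (norm_eq_zero.1 h5)
  subst hy0
  refine ⟨x, hy, fun k => Filter.Eventually.of_forall (hxm k), ?_⟩
  rw [Metric.tendsto_nhds]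
  intro ε hε
  have hlow : Tendsto (fun k => u k y - φ y + φ (x k)) F (𝓝 (v y - φ y + φ y)) :=
    (h0.sub_const _).add hφy
  rw [sub_add_cancel] at hlow
  filter_upwards [hle x y hy (ε / 2) (by linarith), Metric.tendsto_nhds.1 hlow ε hε,
    Metric.tendsto_nhds.1 hvy (ε / 2) (by linarith)] with k h1 h2 h3
  have h4 := hxm k y
  rw [Real.dist_eq, abs_lt] at h2 h3 ⊢
  simp only [Function.comp] at h3
  constructor <;> linarith [h2.1, h2.2, h3.1, h3.2]

/-- Gradient bounds on paraboloid touching imply Lipschitz bounds. -/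
lemma lip_of_touch {n : ℕ} {u : Euc n → ℝ} (hc : Continuous u) (hp : TorusFun u) {K : ℝ}
    (hK : 0 < K)
    (h : ∀ x0 p a, (∀ x, u x ≤ u x0 + ⟪p, x - x0⟫ + a * ‖x - x0‖ ^ 2) → ‖p‖ < K) :
    ∀ x y, |u x - u y| ≤ K * ‖x - y‖ := by
  have key : ∀ x y, u x - u y ≤ K * ‖x - y‖ := by
    intro x y
    obtain ⟨M, hM0, hM⟩ := per_bdd hc hp
    set f : Euc n → ℝ := fun w => u w - K * ‖w - y‖ with hf
    have hfc : Continuous f := by fun_prop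
    obtain ⟨w, -, hw⟩ := (isCompact_closedBall y (2 * M / K)).exists_isMaxOn
      ⟨y, by simp; positivity⟩ hfc.continuousOn
    have hglob : ∀ q, f q ≤ f w := by
      intro q
      by_cases hq : q ∈ Metric.closedBall y (2 * M / K)
      · exact hw hq
      · have h1 : f y ≤ f w := hw (by simp; positivity)
        rw [mem_closedBall_iff_norm, not_le, div_lt_iff₀ hK] at hq
        have h2 := abs_le.1 (hM q)
        have h3 := abs_le.1 (hM y)
        have : f y = u y := by simp [hf]
        have : f q ≤ u y := by simp only [hf]; linarith
        linarith
    by_cases hwy : w = y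
    · have := hglob x
      rw [hwy] at this
      simp [hf] at this
      linarith
    · exfalso
      set r := ‖w - y‖ with hr
      have hr0 : 0 < r := norm_pos_iff.2 (sub_ne_zero.2 hwy)
      have := h w ((K / r) • (w - y)) (K / (2 * r)) (fun q => ?_)
      · rw [norm_smul, Real.norm_of_nonneg (by positivity), ← hr] at this
        field_simp at this
        linarith
      · have h1 := hglob q
        simp only [hf, ← hr] at h1
        have h2 : ‖q - y‖ ^ 2 = r ^ 2 + 2 * ⟪w - y, q - w⟫ + ‖q - w‖ ^ 2 := by
          have : q - y = (w - y) + (q - w) := by abel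
          rw [this, norm_add_sq_real]
        rw [inner_smul_left]
        simp only [conj_trivial]
        have h3 : K * ‖q - y‖ ≤ K * ((‖q - y‖ ^ 2 + r ^ 2) / (2 * r)) := by
          apply mul_le_mul_of_nonneg_left _ hK.le
          rw [le_div_iff₀ (by positivity)]
          nlinarith [sq_nonneg (‖q - y‖ - r)]
        have h4 : K * ((‖q - y‖ ^ 2 + r ^ 2) / (2 * r)) =
            K * r + K / r * ⟪w - y, q - w⟫ + K / (2 * r) * ‖q - w‖ ^ 2 := by
          rw [h2]; field_simp; ring
        linarith
  intro x y
  rw [abs_le]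
  have h1 := key x y
  have h2 := key y x
  rw [norm_sub_rev] at h2
  constructor <;> linarith

lemma SubV.parab {n m : ℕ} {A : Matrix (Fin m) (Fin m) ℝ} {H : Fin m → Euc n → Euc n → ℝ}
    {u : Fin m → Euc n → ℝ} (h : SubV A H u) {i : Fin m} {x0 p : Euc n} {a : ℝ}
    (ht : ∀ x, u i x ≤ u i x0 + ⟪p, x - x0⟫ + a * ‖x - x0‖ ^ 2) :
    (∑ j, A i j * u j x0) + H i x0 p ≤ 0 := by
  obtain ⟨ψ, h1, h2, h3, h4⟩ := parab_test ht
  have := h i ψ h1 h2 x0 h4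
  rwa [h3] at this

lemma GoodH.R {n m : ℕ} {H : Fin m → Euc n → Euc n → ℝ} (hH : GoodH H) (M : ℝ) :
    ∃ R, 0 < R ∧ ∀ i (p x : Euc n), H i x p < M → ‖p‖ < R := by
  choose R hR using fun i => hH.coer i M
  refine ⟨1 + ∑ i, |R i|, by positivity, fun i p x h => ?_⟩
  by_contra hcon
  push Not at hcon
  have h1 : |R i| ≤ ∑ i, |R i| := Finset.single_le_sum (fun j _ => abs_nonneg (R j)) (Finset.mem_univ i)
  have := hR i p (by linarith [le_abs_self (R i)]) x
  linarith

lemma GoodH.bdd0 {n m : ℕ} {H : Fin m → Euc n → Euc n → ℝ} (hH : GoodH H) :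
    ∃ C, 0 ≤ C ∧ ∀ i x, |H i x 0| ≤ C := by
  have : ∀ i, ∃ M, 0 ≤ M ∧ ∀ x, |H i x 0| ≤ M := fun i =>
    per_bdd (f := fun x => H i x 0) ((hH.cont i).comp (by fun_prop : Continuous fun x : Euc n => (x, (0 : Euc n))))
      (fun x z hz => hH.per i x z 0 hz)
  choose M hM0 hM using this
  exact ⟨∑ i, M i, Finset.sum_nonneg fun i _ => hM0 i, fun i x =>
    (hM i x).trans (Finset.single_le_sum (fun j _ => hM0 j) (Finset.mem_univ i))⟩

lemma GoodH.below {n m : ℕ} {H : Fin m → Euc n → Euc n → ℝ} (hH : GoodH H) :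
    ∃ C, 0 ≤ C ∧ ∀ i x p, -C ≤ H i x p := by
  obtain ⟨R, hR0, hR⟩ := hH.R 0
  have : ∀ i, ∃ M, 0 ≤ M ∧ ∀ x p, -M ≤ H i x p := by
    intro i
    obtain ⟨q, -, hq⟩ := ((isCompact_cube (0 : Euc n)).prod
      (isCompact_closedBall (0 : Euc n) R)).exists_isMinOn ⟨(0, 0), inCube_self 0, by simp; exact hR0.le⟩
      (hH.cont i).continuousOn
    refine ⟨|H i q.1 q.2|, abs_nonneg _, fun x p => ?_⟩
    by_cases hx : H i x p < 0
    · obtain ⟨z, hz, hzc⟩ := exists_shift 0 x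
      have h1 : H i q.1 q.2 ≤ H i (x + z) p :=
        hq (a := (x + z, p)) ⟨hzc, by simpa using (hR i p x hx).le⟩
      rw [hH.per i x z p hz] at h1
      linarith [neg_abs_le (H i q.1 q.2)]
    · linarith [abs_nonneg (H i q.1 q.2)]
  choose M hM0 hM using this
  refine ⟨∑ i, M i, Finset.sum_nonneg fun i _ => hM0 i, fun i x p => ?_⟩
  have := Finset.single_le_sum (fun j _ => hM0 j) (Finset.mem_univ i)
  linarith [hM i x p]

lemma sub_upper {n m : ℕ} {A : Matrix (Fin m) (Fin m) ℝ} {H : Fin m → Euc n → Euc n → ℝ}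
    (hA : ∀ i j, i ≠ j → A i j ≤ 0) {s : Fin m → ℝ} (hs : ∀ i, 0 < s i) {C t : ℝ} (ht : 0 ≤ t)
    (hC0 : 0 ≤ C)
    (hC : ∀ i x, |H i x 0| ≤ C) (hAs : ∀ i, C < t * ∑ j, A i j * s j)
    {u : Fin m → Euc n → ℝ} (huc : ∀ i, Continuous (u i)) (hup : ∀ i, TorusFun (u i))
    (hu : SubV A H u) (i : Fin m) (x : Euc n) : u i x ≤ t * s i := by
  choose X hXc hX using fun i => per_exists_max (huc i) (hup i) 0
  obtain ⟨k, -, hk⟩ := Finset.exists_max_image Finset.univ (fun i => u i (X i) / s i) ⟨i, Finset.mem_univ i⟩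
  set τ := u k (X k) / s k with hτ
  have hall : ∀ j y, u j y ≤ τ * s j := fun j y => by
    have := hk j (Finset.mem_univ j)
    rw [div_le_iff₀ (hs j)] at this
    exact (hX j y).trans this
  by_contra hcon
  push Not at hcon
  have hτt : t < τ := by
    have := hcon.trans_le (hall i x)
    exact lt_of_mul_lt_mul_right this (hs i).le
  have hmax := hu k (fun _ => 0) contDiff_const (fun _ _ _ => rfl) (X k)
    (Filter.Eventually.of_forall fun y => by simpa using hX k y)
  have hg : gradient (fun _ : Euc n => (0:ℝ)) (X k) = 0 := by simp [gradient]
  rw [hg] at hmax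
  have h1 : τ * ∑ j, A k j * s j ≤ ∑ j, A k j * u j (X k) := by
    rw [Finset.mul_sum]
    refine Finset.sum_le_sum fun j _ => ?_
    by_cases hjk : k = j
    · subst hjk
      have : u k (X k) = τ * s k := by rw [hτ, div_mul_cancel₀ _ (hs k).ne']
      rw [this]; linarith
    · have := mul_le_mul_of_nonpos_left (hall j (X k)) (hA k j hjk)
      linarith
  have h2 := hAs k
  have h3 : 0 < ∑ j, A k j * s j := by
    by_contra h4
    push Not at h4
    have := mul_nonpos_of_nonneg_of_nonpos ht h4
    linarith
  have h5 : t * ∑ j, A k j * s j ≤ τ * ∑ j, A k j * s j := by gcongr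
  have h6 := abs_le.1 (hC k (X k))
  linarith [h6.1]

/-! ### Perron's method -/

lemma grad_zero_of_fderiv {n : ℕ} {f : Euc n → ℝ} {x : Euc n} (h : fderiv ℝ f x = 0) :
    gradient f x = 0 := by
  simp [gradient, h]

lemma cont_of_lip {n : ℕ} {f : Euc n → ℝ} {K : ℝ} (h : ∀ x y, |f x - f y| ≤ K * ‖x - y‖) :
    Continuous f := by
  have : LipschitzWith (Real.toNNReal K) f := LipschitzWith.of_dist_le_mul fun x y => by
    rw [Real.dist_eq, dist_eq_norm]
    refine (h x y).trans ?_
    gcongr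
    exact Real.le_coe_toNNReal K
  exact this.continuous

def PClass {n m : ℕ} (A : Matrix (Fin m) (Fin m) ℝ) (H : Fin m → Euc n → Euc n → ℝ)
    (b : Fin m → ℝ) (u : Fin m → Euc n → ℝ) : Prop :=
  (∀ i, Continuous (u i)) ∧ (∀ i, TorusFun (u i)) ∧ SubV A H u ∧ ∀ i x, -b i ≤ u i x

/-- The bump construction. -/
lemma bump {n m : ℕ} {A : Matrix (Fin m) (Fin m) ℝ} {H : Fin m → Euc n → Euc n → ℝ}
    (hH : GoodH H) (hA : ∀ i j, i ≠ j → A i j ≤ 0) {b : Fin m → ℝ} {v : Fin m → Euc n → ℝ}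
    (hv : PClass A H b v) (hmax : ∀ w, PClass A H b w → ∀ i x, w i x ≤ v i x) :
    SuperV A H v := by
  obtain ⟨hvc, hvp, hvs, hvb⟩ := hv
  intro i ψ hψ hψp x0 hloc
  by_contra hcon
  push Not at hcon
  -- globalize
  have hloc' : IsLocalMax (fun y => (-v i y) - (-ψ y)) x0 := by
    filter_upwards [hloc] with y hy
    linarith
  obtain ⟨φ', ⟨hφ1, hφp, ht⟩, hgrad⟩ := globalize (u := fun y => -v i y) (ψ := fun y => -ψ y)
    (hvc i).neg (fun x z hz => by simp only [hvp i x z hz]) hψ.neg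
    (fun x z hz => by simp only [hψp x z hz]) hloc'
  set φ : Euc n → ℝ := fun y => -φ' y + (φ' x0 + v i x0) with hφ
  have hφc1 : ContDiff ℝ 1 φ := hφ1.neg.add contDiff_const
  have hφper : TorusFun φ := fun x z hz => by simp only [hφ, hφp x z hz]
  have hφv : ∀ x, φ x + etaF x0 x ≤ v i x := fun x => by
    have := ht x
    simp only [hφ]; linarith
  have hφ0 : φ x0 = v i x0 := by simp [hφ]
  have hφg : gradient φ x0 = gradient ψ x0 := by
    have e1 : ∀ x, fderiv ℝ φ x = - fderiv ℝ φ' x := fun x => by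
      simp only [hφ]
      rw [fderiv_add_const]; exact fderiv_neg
    have e2 : fderiv ℝ (fun y => -ψ y) x0 = - fderiv ℝ ψ x0 := fderiv_neg
    unfold gradient at hgrad
    have e3 := (InnerProductSpace.toDual ℝ (Euc n)).symm.injective hgrad
    apply grad_eq_of_fderiv
    rw [e1, e3, e2, neg_neg]
  -- the function G
  set G : Euc n × ℝ → ℝ := fun q => A i i * (φ q.1 + q.2) +
    (∑ j ∈ Finset.univ.erase i, A i j * v j q.1) + H i q.1 (gradient φ q.1) with hG
  have hGc : Continuous G := by
    have h1 : Continuous fun q : Euc n × ℝ => H i q.1 (gradient φ q.1) :=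
      (hH.cont i).comp (continuous_fst.prodMk ((grad_cont hφc1).comp continuous_fst))
    have h2 : Continuous fun q : Euc n × ℝ => ∑ j ∈ Finset.univ.erase i, A i j * v j q.1 :=
      continuous_finsetSum _ fun j _ => continuous_const.mul ((hvc j).comp continuous_fst)
    have h3 : Continuous fun q : Euc n × ℝ => A i i * (φ q.1 + q.2) :=
      continuous_const.mul ((hφc1.continuous.comp continuous_fst).add continuous_snd)
    exact (h3.add h2).add h1
  have hG0 : G (x0, 0) < 0 := by
    simp only [hG, hφ0, hφg, add_zero]
    rw [Finset.add_sum_erase Finset.univ (fun j => A i j * v j x0) (Finset.mem_univ i)]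
    exact hcon
  have hGp : ∀ x z δ, IsIntVec z → G (x + z, δ) = G (x, δ) := fun x z δ hz => by
    simp only [hG, hφper x z hz, grad_per hφper x z hz, hH.per i x z _ hz]
    congr 2
    exact Finset.sum_congr rfl fun j _ => by rw [hvp j x z hz]
  obtain ⟨r, hr, hball⟩ := Metric.eventually_nhds_iff.1 (hGc.continuousAt.eventually_lt
    (continuousAt_const (y := (0:ℝ))) hG0)
  set δ := min (r / 2) (r ^ 2) with hδ
  have hδ0 : 0 < δ := by positivity
  have hneg : ∀ x, v i x < φ x + δ → G (x, δ) < 0 := by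
    intro x hx
    have h1 : etaF x0 x < δ := by linarith [hφv x]
    obtain ⟨z, hz, hzc⟩ := exists_shift x0 x
    rw [← etaF_per x0 x z hz] at h1
    rw [← hGp x z δ hz]
    have h2 := etaF_ge hzc
    apply hball
    rw [Prod.dist_eq, max_lt_iff, dist_eq_norm, Real.dist_eq]
    refine ⟨?_, ?_⟩
    · have : 8 * ‖x + z - x0‖ ^ 2 < r ^ 2 := by linarith [min_le_right (r / 2) (r ^ 2)]
      by_contra hc
      push Not at hc
      simp only at hc
      nlinarith
    · simp only [sub_zero, abs_of_pos hδ0]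
      linarith [min_le_left (r / 2) (r ^ 2)]
  set w : Fin m → Euc n → ℝ := Function.update v i (fun x => max (v i x) (φ x + δ)) with hw
  have hwi : w i = fun x => max (v i x) (φ x + δ) := by simp [hw]
  have hwj : ∀ j, j ≠ i → w j = v j := fun j hj => by simp [hw, hj]
  have hvw : ∀ j x, v j x ≤ w j x := fun j x => by
    by_cases hj : j = i
    · subst hj; rw [hwi]; exact le_max_left _ _
    · rw [hwj j hj]
  have hwP : PClass A H b w := by
    refine ⟨fun j => ?_, fun j => ?_, ?_, fun j x => (hvb j x).trans (hvw j x)⟩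
    · by_cases hj : j = i
      · subst hj; rw [hwi]
        exact (hvc j).max (hφc1.continuous.add continuous_const)
      · rw [hwj j hj]; exact hvc j
    · by_cases hj : j = i
      · subst hj; rw [hwi]
        intro x z hz
        simp only [hvp j x z hz, hφper x z hz]
      · rw [hwj j hj]; exact hvp j
    · intro j χ hχ hχp x hx
      by_cases hcase : v j x = w j x
      · -- test `v`
        have h1 : IsLocalMax (fun y => v j y - χ y) x := by
          filter_upwards [hx] with y hy
          have := hvw j y
          linarith
        have h2 := hvs j χ hχ hχp x h1
        have h3 : ∑ l, A j l * w l x ≤ ∑ l, A j l * v l x := by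
          refine Finset.sum_le_sum fun l _ => ?_
          by_cases hl : j = l
          · subst hl; rw [hcase]
          · exact mul_le_mul_of_nonpos_left (hvw l x) (hA j l hl)
        linarith
      · have hj : j = i := by
          by_contra hj
          exact hcase (by rw [hwj j hj])
        subst hj
        have hlt : v j x < φ x + δ := by
          by_contra hc
          push Not at hc
          apply hcase
          rw [hwi]; exact (max_eq_left hc).symm
        have hwx : w j x = φ x + δ := by rw [hwi]; exact max_eq_right hlt.le
        have h1 : IsLocalMax (fun y => φ y - χ y) x := by
          filter_upwards [hx] with y hy
          have : φ y + δ ≤ w j y := by rw [hwi]; exact le_max_right _ _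
          linarith
        have h2 := h1.fderiv_eq_zero
        rw [fderiv_fun_sub (hφc1.differentiable one_ne_zero x) (hχ.differentiable one_ne_zero x),
          sub_eq_zero] at h2
        rw [← grad_eq_of_fderiv h2]
        have h3 := hneg x hlt
        simp only [hG] at h3
        rw [← Finset.add_sum_erase Finset.univ (fun l => A j l * w l x) (Finset.mem_univ j)]
        simp only [hwx]
        have h4 : ∑ l ∈ Finset.univ.erase j, A j l * w l x =
            ∑ l ∈ Finset.univ.erase j, A j l * v l x :=
          Finset.sum_congr rfl fun l hl => by rw [hwj l (Finset.ne_of_mem_erase hl)]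
        rw [h4]
        exact h3.le
  have h1 := hmax w hwP i x0
  rw [hwi] at h1
  have h2 : φ x0 + δ ≤ v i x0 := (le_max_right _ _).trans h1
  rw [hφ0] at h2
  linarith

theorem perron {n m : ℕ} {A : Matrix (Fin m) (Fin m) ℝ} {H : Fin m → Euc n → Euc n → ℝ}
    (hH : GoodH H) (hA : ∀ i j, i ≠ j → A i j ≤ 0) {s : Fin m → ℝ} (hs : ∀ i, 0 < s i) {C t : ℝ}
    (ht : 0 ≤ t) (hC0 : 0 ≤ C)
    (hC : ∀ i x, |H i x 0| ≤ C) (hAs : ∀ i, C < t * ∑ j, A i j * s j) :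
    ∃ v : Fin m → Euc n → ℝ, (∃ K > 0, ∀ i x y, |v i x - v i y| ≤ K * ‖x - y‖) ∧
      (∀ i, TorusFun (v i)) ∧ SubV A H v ∧ SuperV A H v ∧ ∀ i x, |v i x| ≤ t * s i := by
  set b : Fin m → ℝ := fun i => t * s i with hb
  have hub : ∀ u, PClass A H b u → ∀ i x, u i x ≤ b i := fun u hu =>
    sub_upper hA hs ht hC0 hC hAs hu.1 hu.2.1 hu.2.2.1
  -- Lipschitz
  set M0 := ∑ i, ∑ j, |A i j| * b j + 1 with hM0
  obtain ⟨K, hK0, hK⟩ := hH.R M0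
  have hb0 : ∀ j, 0 ≤ b j := fun j => mul_nonneg ht (hs j).le
  have hlip : ∀ u, PClass A H b u → ∀ i x y, |u i x - u i y| ≤ K * ‖x - y‖ := by
    intro u hu i
    refine lip_of_touch (hu.1 i) (hu.2.1 i) hK0 fun x0 p a htouch => ?_
    have h1 := hu.2.2.1.parab htouch
    apply hK i p x0
    have h2 : -(∑ j, A i j * u j x0) ≤ ∑ j, |A i j| * b j := by
      rw [← Finset.sum_neg_distrib]
      refine Finset.sum_le_sum fun j _ => ?_
      refine (neg_le_abs _).trans ?_
      rw [abs_mul]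
      exact mul_le_mul_of_nonneg_left (abs_le.2 ⟨hu.2.2.2 j x0, hub u hu j x0⟩) (abs_nonneg _)
    have h3 : ∑ j, |A i j| * b j ≤ ∑ i, ∑ j, |A i j| * b j :=
      Finset.single_le_sum (f := fun i => ∑ j, |A i j| * b j)
        (fun k _ => Finset.sum_nonneg fun j _ => mul_nonneg (abs_nonneg _) (hb0 j))
        (Finset.mem_univ i)
    linarith
  -- constants
  have hconst : PClass A H b (fun i (_ : Euc n) => -b i) := by
    refine ⟨fun i => continuous_const, fun i _ _ _ => rfl, ?_, fun i x => le_rfl⟩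
    intro i ψ hψ hψp x hx
    have h1 : IsLocalMin ψ x := by
      filter_upwards [hx] with y hy
      linarith
    rw [grad_zero_of_fderiv h1.fderiv_eq_zero]
    have h2 : ∑ j, A i j * -b j = - (t * ∑ j, A i j * s j) := by
      rw [Finset.mul_sum, ← Finset.sum_neg_distrib]
      exact Finset.sum_congr rfl fun j _ => by simp only [hb]; ring
    rw [h2]
    linarith [hAs i, (abs_le.1 (hC i x)).2]
  have : Nonempty {u // PClass A H b u} := ⟨⟨_, hconst⟩⟩
  set v : Fin m → Euc n → ℝ := fun i x => ⨆ u : {u // PClass A H b u}, u.1 i x with hv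
  have hbdd : ∀ i x, BddAbove (Set.range fun u : {u // PClass A H b u} => u.1 i x) := fun i x =>
    ⟨b i, by rintro _ ⟨u, rfl⟩; exact hub u.1 u.2 i x⟩
  have hle : ∀ u, PClass A H b u → ∀ i x, u i x ≤ v i x := fun u hu i x =>
    le_ciSup (hbdd i x) ⟨u, hu⟩
  have hvb : ∀ i x, v i x ≤ b i := fun i x => ciSup_le fun u => hub u.1 u.2 i x
  have hvl : ∀ i x, -b i ≤ v i x := fun i x => hle _ hconst i x
  have hvlip : ∀ i x y, |v i x - v i y| ≤ K * ‖x - y‖ := by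
    have key : ∀ i x y, v i x ≤ v i y + K * ‖x - y‖ := fun i x y =>
      ciSup_le fun u => by
        have h1 := hle u.1 u.2 i y
        have h2 := (abs_le.1 (hlip u.1 u.2 i x y)).2
        linarith
    intro i x y
    have h1 := key i x y
    have h2 := key i y x
    rw [norm_sub_rev] at h2
    rw [abs_le]
    constructor <;> linarith
  have hvc : ∀ i, Continuous (v i) := fun i => cont_of_lip (hvlip i)
  have hvp : ∀ i, TorusFun (v i) := fun i x z hz => by
    simp only [hv]
    congr 1
    funext u
    exact u.2.2.1 i x z hz
  have hvsub : SubV A H v := by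
    intro i ψ hψ hψp x0 hx0
    obtain ⟨φ, hφ, hg⟩ := globalize (hvc i) (hvp i) hψ hψp hx0
    rw [← hg]
    have hex : ∀ k : ℕ, ∃ u, PClass A H b u ∧ v i x0 - 1 / ((k:ℝ) + 1) < u i x0 := fun k => by
      have h1 : v i x0 - 1 / ((k:ℝ) + 1) < v i x0 := by
        have : (0:ℝ) < 1 / ((k:ℝ) + 1) := by positivity
        linarith
      obtain ⟨u, hu⟩ := exists_lt_of_lt_ciSup h1
      exact ⟨u.1, u.2, hu⟩
    choose u huP hu using hex
    set F : Ultrafilter ℕ := hyperfilter ℕ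
    have hF : (F : Filter ℕ) ≤ atTop := by
      rw [← Nat.cofinite_eq_atTop]; exact hyperfilter_le_cofinite
    have h0 : Tendsto (fun k => u k i x0) F (𝓝 (v i x0)) := by
      have h1 : Tendsto (fun k : ℕ => v i x0 - 1 / ((k:ℝ) + 1)) F (𝓝 (v i x0 - 0)) :=
        (tendsto_const_nhds.sub tendsto_one_div_add_atTop_nhds_zero_nat).mono_left hF
      rw [sub_zero] at h1
      exact tendsto_of_tendsto_of_tendsto_of_le_of_le h1 tendsto_const_nhds
        (fun k => (hu k).le) (fun k => hle _ (huP k) i x0)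
    obtain ⟨x, hx, hxm, hxv⟩ := touch_limit F (u := fun k => u k i) (fun k => (huP k).1 i)
      (fun k => (huP k).2.1 i) (hvc i) hφ h0
      (fun x y _ ε hε => Filter.Eventually.of_forall fun k => by
        linarith [hle _ (huP k) i (x k)])
    have h2 : ∀ k, A i i * u k i (x k) + (∑ j ∈ Finset.univ.erase i, A i j * v j (x k)) +
        H i (x k) (gradient φ (x k)) ≤ 0 := by
      intro k
      have h3 := (huP k).2.2.1 i φ hφ.1 hφ.2.1 (x k) (hxm k)
      rw [← Finset.add_sum_erase Finset.univ (fun j => A i j * u k j (x k)) (Finset.mem_univ i)] at h3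
      have h4 : ∑ j ∈ Finset.univ.erase i, A i j * v j (x k) ≤
          ∑ j ∈ Finset.univ.erase i, A i j * u k j (x k) := by
        refine Finset.sum_le_sum fun j hj => ?_
        exact mul_le_mul_of_nonpos_left (hle _ (huP k) j (x k))
          (hA i j (Finset.ne_of_mem_erase hj).symm)
      linarith
    have h5 : Tendsto (fun k => A i i * u k i (x k) +
        (∑ j ∈ Finset.univ.erase i, A i j * v j (x k)) + H i (x k) (gradient φ (x k))) F
        (𝓝 (A i i * v i x0 + (∑ j ∈ Finset.univ.erase i, A i j * v j x0) +
          H i x0 (gradient φ x0))) := by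
      refine ((hxv.const_mul _).add ?_).add ?_
      · exact tendsto_finsetSum _ fun j _ => (((hvc j).tendsto x0).comp hx).const_mul _
      · have hcc : Continuous fun y : Euc n => H i y (gradient φ y) :=
          (hH.cont i).comp (continuous_id.prodMk (grad_cont hφ.1))
        exact (hcc.tendsto x0).comp hx
    rw [← Finset.add_sum_erase Finset.univ (fun j => A i j * v j x0) (Finset.mem_univ i)]
    exact le_of_tendsto h5 (Filter.Eventually.of_forall h2)
  have hvP : PClass A H b v := ⟨hvc, hvp, hvsub, hvl⟩
  exact ⟨v, ⟨K, hK0, hvlip⟩, hvp, hvsub, bump hH hA hvP hle,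
    fun i x => abs_le.2 ⟨hvl i x, hvb i x⟩⟩

/-! ### Linear algebra -/

lemma mono_offdiag {m : ℕ} {B : Matrix (Fin m) (Fin m) ℝ} (hB : IsMonotoneMat B) (i j : Fin m)
    (hij : i ≠ j) : B i j ≤ 0 := by
  have := hB (fun l => if l = j then -1 else 0) i (fun l => by
    simp only [hij, if_false]; split_ifs <;> norm_num) (by simp [hij])
  simp at this
  exact this

lemma mono_rowsum {m : ℕ} {B : Matrix (Fin m) (Fin m) ℝ} (hB : IsMonotoneMat B) (i : Fin m) :
    0 ≤ ∑ j, B i j := by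
  have := hB (fun _ => 1) i (fun l => le_rfl) zero_le_one
  simpa using this

lemma ker_nonpos {m : ℕ} {B : Matrix (Fin m) (Fin m) ℝ} (hB : IsMonotoneMat B)
    (hirr : ∀ I : Set (Fin m), I.Nonempty → I ≠ Set.univ → ∃ i ∈ I, ∃ j ∉ I, B i j ≠ 0)
    {i0 : Fin m} (hi0 : 0 < ∑ j, B i0 j) {a : Fin m → ℝ} (ha : ∀ i, ∑ j, B i j * a j = 0) :
    ∀ i, a i ≤ 0 := by
  obtain ⟨k, -, hk⟩ := Finset.exists_max_image Finset.univ a ⟨i0, Finset.mem_univ _⟩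
  have hk' : ∀ j, a j ≤ a k := fun j => hk j (Finset.mem_univ j)
  by_contra hcon
  push Not at hcon
  obtain ⟨i, hi⟩ := hcon
  have hak : 0 < a k := hi.trans_le (hk' i)
  by_cases hI : {i | a i = a k} = Set.univ
  · have h1 := ha i0
    have h2 : ∑ j, B i0 j * a j = (∑ j, B i0 j) * a k := by
      rw [Finset.sum_mul]
      refine Finset.sum_congr rfl fun j _ => ?_
      have : j ∈ {i | a i = a k} := hI ▸ Set.mem_univ j
      rw [show a j = a k from this]
    rw [h2] at h1
    exact (mul_pos hi0 hak).ne' h1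
  · obtain ⟨i, hi, j, hj, hij⟩ := hirr {i | a i = a k} ⟨k, rfl⟩ hI
    have hai : a i = a k := hi
    have haj : a j < a k := lt_of_le_of_ne (hk' j) hj
    have hne : i ≠ j := fun h => hj (h ▸ hi)
    have h1 : ∑ l, B i l * a l = (∑ l, B i l) * a k + ∑ l, (-B i l) * (a k - a l) := by
      rw [Finset.sum_mul, ← Finset.sum_add_distrib]
      exact Finset.sum_congr rfl fun l _ => by ring
    have h2 : (-B i j) * (a k - a j) ≤ ∑ l, (-B i l) * (a k - a l) := by
      refine Finset.single_le_sum (f := fun l => (-B i l) * (a k - a l)) (fun l _ => ?_)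
        (Finset.mem_univ j)
      by_cases hl : i = l
      · subst hl; simp [hai]
      · exact mul_nonneg (by linarith [mono_offdiag hB i l hl]) (by linarith [hk' l])
    have h3 : 0 < (-B i j) * (a k - a j) := by
      have := lt_of_le_of_ne (mono_offdiag hB i j hne) hij
      exact mul_pos (by linarith) (by linarith)
    have h4 := mul_nonneg (mono_rowsum hB i) hak.le
    have h5 := ha i
    linarith

lemma exists_s {m : ℕ} {B : Matrix (Fin m) (Fin m) ℝ} (hB : IsMonotoneMat B)
    (hirr : ∀ I : Set (Fin m), I.Nonempty → I ≠ Set.univ → ∃ i ∈ I, ∃ j ∉ I, B i j ≠ 0)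
    {i0 : Fin m} (hi0 : 0 < ∑ j, B i0 j) :
    ∃ s : Fin m → ℝ, (∀ i, 0 < s i) ∧ ∀ i, ∑ j, B i j * s j = 1 := by
  have hinj : Function.Injective (Matrix.mulVecLin B) := by
    rw [← LinearMap.ker_eq_bot, LinearMap.ker_eq_bot']
    intro a ha
    have h0 : ∀ i, ∑ j, B i j * a j = 0 := fun i => by
      have := congrFun ha i
      simpa [Matrix.mulVec, dotProduct] using this
    have h1 := ker_nonpos hB hirr hi0 h0
    have h2 := ker_nonpos hB hirr hi0 (a := fun i => -a i) (fun i => by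
      simp only [mul_neg, Finset.sum_neg_distrib, h0 i, neg_zero])
    funext i
    simp only [Pi.zero_apply]
    linarith [h1 i, h2 i]
  obtain ⟨s, hs⟩ := (LinearMap.injective_iff_surjective.1 hinj) (fun _ => 1)
  have hs' : ∀ i, ∑ j, B i j * s j = 1 := fun i => by
    have := congrFun hs i
    simpa [Matrix.mulVec, dotProduct] using this
  refine ⟨s, fun i => ?_, hs'⟩
  obtain ⟨k, -, hk⟩ := Finset.exists_min_image Finset.univ s ⟨i0, Finset.mem_univ _⟩
  have hk0 : 0 < s k := by
    by_contra hcon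
    push Not at hcon
    have := hB (fun j => -s j) k (fun j => by linarith [hk j (Finset.mem_univ j)]) (by linarith)
    simp only [mul_neg, Finset.sum_neg_distrib, hs' k] at this
    linarith
  exact hk0.trans_le (hk i (Finset.mem_univ i))

lemma propagate {m : ℕ} {B : Matrix (Fin m) (Fin m) ℝ} (hoff : ∀ i j, i ≠ j → B i j ≤ 0)
    (hirr : ∀ I : Set (Fin m), I.Nonempty → I ≠ Set.univ → ∃ i ∈ I, ∃ j ∉ I, B i j ≠ 0)
    (hrow : ∀ i, ∑ j, B i j = 0) (C : ℝ) (hC : 0 ≤ C) :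
    ∃ D, 0 ≤ D ∧ ∀ a : Fin m → ℝ, (∀ i, ∑ j, B i j * a j ≤ C) → ∀ i j, |a i - a j| ≤ D := by
  have key : ∀ i j, ∃ D, 0 ≤ D ∧ ∀ a : Fin m → ℝ, (∀ i, ∑ j, B i j * a j ≤ C) →
      (∀ l, a l ≤ a i) → a i - a j ≤ D := by
    intro k
    by_contra hcon
    set I : Set (Fin m) := {j | ∃ D, 0 ≤ D ∧ ∀ a : Fin m → ℝ, (∀ i, ∑ j, B i j * a j ≤ C) →
      (∀ l, a l ≤ a k) → a k - a j ≤ D} with hI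
    have hIne : I ≠ Set.univ := fun h => hcon fun j => by
      have : j ∈ I := h ▸ Set.mem_univ j
      exact this
    obtain ⟨i, ⟨D, hD0, hD⟩, j, hj, hij⟩ := hirr I ⟨k, 0, le_rfl, fun a _ _ => by simp⟩ hIne
    apply hj
    have hne : i ≠ j := fun h => hj (h ▸ ⟨D, hD0, hD⟩)
    have hneg : 0 < -B i j := by
      have := lt_of_le_of_ne (hoff i j hne) hij
      linarith
    have hS0 : 0 ≤ ∑ l, |B i l| := Finset.sum_nonneg fun l _ => abs_nonneg _
    refine ⟨D + (C + D * ∑ l, |B i l|) / (-B i j), by positivity, fun a ha hak => ?_⟩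
    have h1 : ∑ l, B i l * a l = ∑ l, (-B i l) * (a i - a l) := by
      have : ∑ l, (-B i l) * (a i - a l) = ∑ l, B i l * a l - (∑ l, B i l) * a i := by
        rw [Finset.sum_mul, ← Finset.sum_sub_distrib]
        exact Finset.sum_congr rfl fun l _ => by ring
      rw [this, hrow i]; ring
    have hge : ∀ l, -D ≤ a i - a l := fun l => by linarith [hak l, hD a ha hak]
    have h2 : (-B i j) * (a i - a j + D) ≤ ∑ l, ((-B i l) * (a i - a l) + |B i l| * D) := by
      have hnn : ∀ l ∈ Finset.univ, 0 ≤ (-B i l) * (a i - a l) + |B i l| * D := fun l _ => by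
        by_cases hl : i = l
        · subst hl; simp; positivity
        · have := hoff i l hl
          rw [abs_of_nonpos this]
          nlinarith [hge l]
      have h3 := Finset.single_le_sum hnn (Finset.mem_univ j)
      rw [abs_of_neg (by linarith : B i j < 0)] at h3
      linarith
    rw [Finset.sum_add_distrib, ← h1, ← Finset.sum_mul] at h2
    have h4 := ha i
    have h5 : a i - a j + D ≤ (C + D * ∑ l, |B i l|) / (-B i j) := by
      rw [le_div_iff₀ hneg]
      linarith
    linarith [hD a ha hak]
  choose D hD0 hD using key
  have hsum : ∀ i j, D i j ≤ ∑ i, ∑ j, D i j := fun i j =>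
    (Finset.single_le_sum (fun l _ => hD0 i l) (Finset.mem_univ j)).trans
      (Finset.single_le_sum (f := fun i => ∑ j, D i j)
        (fun l _ => Finset.sum_nonneg fun j _ => hD0 l j) (Finset.mem_univ i))
  refine ⟨∑ i, ∑ j, D i j, Finset.sum_nonneg fun i _ => Finset.sum_nonneg fun j _ => hD0 i j,
    fun a ha i j => ?_⟩
  obtain ⟨k, -, hk⟩ := Finset.exists_max_image Finset.univ a ⟨i, Finset.mem_univ _⟩
  have hk' : ∀ l, a l ≤ a k := fun l => hk l (Finset.mem_univ l)
  have h1 := (hD k i a ha hk').trans (hsum k i)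
  have h2 := (hD k j a ha hk').trans (hsum k j)
  rw [abs_le]
  have hki := hk' i
  have hkj := hk' j
  constructor <;> linarith [hki, hkj]

/-- Pointwise bound on the coupling of a subsolution. -/
lemma coupling_le {n m : ℕ} {A : Matrix (Fin m) (Fin m) ℝ} {H : Fin m → Euc n → Euc n → ℝ}
    {u : Fin m → Euc n → ℝ} (huc : ∀ i, Continuous (u i)) (hup : ∀ i, TorusFun (u i))
    (hu : SubV A H u) {C0 : ℝ} (hC0 : ∀ i x p, -C0 ≤ H i x p) (i : Fin m) (x : Euc n) :
    ∑ j, A i j * u j x ≤ C0 := by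
  by_contra hcon
  push Not at hcon
  have hc : Continuous fun y => ∑ j, A i j * u j y :=
    continuous_finsetSum _ fun j _ => continuous_const.mul (huc j)
  obtain ⟨r, hr, hball⟩ := Metric.eventually_nhds_iff.1
    ((continuousAt_const (y := C0)).eventually_lt hc.continuousAt hcon)
  obtain ⟨M, hM0, hM⟩ := per_bdd (huc i) (hup i)
  set ρ := r / 2 with hρ
  have hρ0 : 0 < ρ := by positivity
  set N := (2 * M + 1) / ρ ^ 2 with hN
  have hN0 : 0 ≤ N := by positivity
  set f : Euc n → ℝ := fun y => u i y - N * ‖y - x‖ ^ 2 with hf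
  have hfc : Continuous f := by have := huc i; fun_prop
  obtain ⟨w, hwb, hw⟩ := (isCompact_closedBall x ρ).exists_isMaxOn
    ⟨x, by simp [hρ0.le]⟩ hfc.continuousOn
  have hglob : ∀ q, f q ≤ f w := by
    intro q
    by_cases hq : q ∈ Metric.closedBall x ρ
    · exact hw hq
    · have h1 : f x ≤ f w := hw (by simp [hρ0.le])
      rw [mem_closedBall_iff_norm, not_le] at hq
      have h2 := abs_le.1 (hM q)
      have h3 := abs_le.1 (hM x)
      have h4 : f x = u i x := by simp [hf]
      have h5 : N * ρ ^ 2 ≤ N * ‖q - x‖ ^ 2 := by gcongr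
      have h6 : N * ρ ^ 2 = 2 * M + 1 := by rw [hN]; field_simp
      have h7 : f q = u i q - N * ‖q - x‖ ^ 2 := rfl
      linarith [h2.2, h3.1]
  have htouch : ∀ q, u i q ≤ u i w + ⟪(2 * N) • (w - x), q - w⟫ + N * ‖q - w‖ ^ 2 := by
    intro q
    have h1 := hglob q
    simp only [hf] at h1
    have h2 : ‖q - x‖ ^ 2 = ‖w - x‖ ^ 2 + 2 * ⟪w - x, q - w⟫ + ‖q - w‖ ^ 2 := by
      have : q - x = (w - x) + (q - w) := by abel
      rw [this, norm_add_sq_real]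
    rw [inner_smul_left]
    simp only [conj_trivial]
    rw [h2] at h1
    linarith
  have h1 := hu.parab htouch
  have h2 : C0 < ∑ j, A i j * u j w := hball (by
    rw [Metric.mem_closedBall] at hwb
    linarith)
  linarith [hC0 i w ((2 * N) • (w - x))]

lemma grad_neg' {n : ℕ} (f : Euc n → ℝ) (x : Euc n) :
    gradient (fun y => -f y) x = -gradient f x := by
  have : fderiv ℝ (fun y => -f y) x = -fderiv ℝ f x := fderiv_neg
  simp [gradient, this]

/-- The singular case, by vanishing discount. -/
theorem discount {n m : ℕ} (hm : 0 < m) {B : Matrix (Fin m) (Fin m) ℝ}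
    (hoff : ∀ i j, i ≠ j → B i j ≤ 0)
    (hirr : ∀ I : Set (Fin m), I.Nonempty → I ≠ Set.univ → ∃ i ∈ I, ∃ j ∉ I, B i j ≠ 0)
    (hrow : ∀ i, ∑ j, B i j = 0) {H : Fin m → Euc n → Euc n → ℝ} (hH : GoodH H) :
    ∃ (c : ℝ) (w : Fin m → Euc n → ℝ), (∃ K > 0, ∀ i x y, |w i x - w i y| ≤ K * ‖x - y‖) ∧
      (∀ i, TorusFun (w i)) ∧ SubV B (fun i x p => H i x p - c) w ∧
      SuperV B (fun i x p => H i x p - c) w := by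
  obtain ⟨C, hC0, hC⟩ := hH.bdd0
  obtain ⟨C0, hC00, hC0'⟩ := hH.below
  set i0 : Fin m := ⟨0, hm⟩
  set lam : ℕ → ℝ := fun k => 1 / ((k:ℝ) + 1) with hlam
  have hlam0 : ∀ k, 0 < lam k := fun k => by simp only [hlam]; positivity
  set A : ℕ → Matrix (Fin m) (Fin m) ℝ := fun k => lam k • (1 : Matrix (Fin m) (Fin m) ℝ) + B with hAdef
  have hAsum : ∀ k i (a : Fin m → ℝ), ∑ j, A k i j * a j = lam k * a i + ∑ j, B i j * a j := by
    intro k i a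
    simp only [hAdef, Matrix.add_apply, Matrix.smul_apply, Matrix.one_apply, smul_eq_mul, add_mul,
      Finset.sum_add_distrib]
    simp
  have hex : ∀ k, ∃ v : Fin m → Euc n → ℝ, (∃ K > 0, ∀ i x y, |v i x - v i y| ≤ K * ‖x - y‖) ∧
      (∀ i, TorusFun (v i)) ∧ SubV (A k) H v ∧ SuperV (A k) H v ∧
      ∀ i x, |v i x| ≤ (C + 1) / lam k * 1 := by
    intro k
    refine perron (s := fun _ => 1) hH (fun i j hij => ?_) (fun _ => one_pos)
      (div_nonneg (by linarith) (hlam0 k).le) hC0 hC (fun i => ?_)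
    · simp only [hAdef, Matrix.add_apply, Matrix.smul_apply, Matrix.one_apply_ne hij, smul_zero,
        zero_add]
      exact hoff i j hij
    · rw [hAsum]
      simp only [mul_one, hrow i, add_zero]
      rw [div_mul_cancel₀ _ (hlam0 k).ne']
      linarith
  choose V hVlip' hVp hVsub hVsup hVb using hex
  have hVc : ∀ k i, Continuous (V k i) := fun k i => by
    obtain ⟨K, -, hK⟩ := hVlip' k
    exact cont_of_lip (hK i)
  have hlV : ∀ k i x, |lam k * V k i x| ≤ C + 1 := fun k i x => by
    rw [abs_mul, abs_of_pos (hlam0 k)]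
    have := hVb k i x
    rw [mul_one, le_div_iff₀ (hlam0 k)] at this
    linarith
  obtain ⟨D, hD0, hD⟩ := propagate hoff hirr hrow (C0 + (C + 1)) (by linarith)
  have hdiff : ∀ k x i j, |V k i x - V k j x| ≤ D := fun k x =>
    hD (fun i => V k i x) fun i => by
      have h1 := coupling_le (hVc k) (hVp k) (hVsub k) hC0' i x
      rw [hAsum] at h1
      linarith [(abs_le.1 (hlV k i x)).1]
  -- uniform Lipschitz bound
  obtain ⟨K, hK0, hK⟩ := hH.R ((C + 1) + D * (∑ i, ∑ j, |B i j|) + 1)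
  have hlip : ∀ k i x y, |V k i x - V k i y| ≤ K * ‖x - y‖ := by
    intro k i
    refine lip_of_touch (hVc k i) (hVp k i) hK0 fun x0 p a ht => ?_
    have h1 := (hVsub k).parab ht
    rw [hAsum] at h1
    apply hK i p x0
    have h2 : ∑ j, B i j * V k j x0 = ∑ j, B i j * (V k j x0 - V k i x0) := by
      have : ∑ j, B i j * (V k j x0 - V k i x0) =
          ∑ j, B i j * V k j x0 - (∑ j, B i j) * V k i x0 := by
        rw [Finset.sum_mul, ← Finset.sum_sub_distrib]
        exact Finset.sum_congr rfl fun l _ => by ring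
      rw [this, hrow i]; ring
    have h3 : -(∑ j, B i j * (V k j x0 - V k i x0)) ≤ ∑ j, |B i j| * D := by
      rw [← Finset.sum_neg_distrib]
      refine Finset.sum_le_sum fun j _ => ?_
      refine (neg_le_abs _).trans ?_
      rw [abs_mul]
      exact mul_le_mul_of_nonneg_left (hdiff k x0 j i) (abs_nonneg _)
    have h4 : ∑ j, |B i j| ≤ ∑ i, ∑ j, |B i j| :=
      Finset.single_le_sum (f := fun i => ∑ j, |B i j|)
        (fun k _ => Finset.sum_nonneg fun j _ => abs_nonneg _) (Finset.mem_univ i)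
    rw [← Finset.sum_mul] at h3
    have h5 := mul_le_mul_of_nonneg_right h4 hD0
    linarith [(abs_le.1 (hlV k i x0)).1]
  -- normalise and pass to the limit
  set U : ℕ → Fin m → Euc n → ℝ := fun k i x => V k i x - V k i0 0 with hU
  set F : Ultrafilter ℕ := hyperfilter ℕ
  have hF : (F : Filter ℕ) ≤ atTop := by
    rw [← Nat.cofinite_eq_atTop]; exact hyperfilter_le_cofinite
  have hUb : ∀ i x k, U k i x ∈ Set.Icc (-(D + K * ‖x‖)) (D + K * ‖x‖) := fun i x k => by
    have h1 := abs_le.1 (hlip k i x 0)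
    have h2 := abs_le.1 (hdiff k 0 i i0)
    rw [sub_zero] at h1
    simp only [hU, Set.mem_Icc]
    constructor <;> linarith [h1.1, h1.2, h2.1, h2.2]
  choose W hWm hW using fun i x => ultra_lim (F := F) isCompact_Icc (hUb i x)
  obtain ⟨c0, -, hc0⟩ := ultra_lim (F := F) isCompact_Icc
    (x := fun k => lam k * V k i0 0) (fun k => Set.mem_Icc.2 (abs_le.1 (hlV k i0 0)))
  have hUlip : ∀ k i x y, |U k i x - U k i y| ≤ K * ‖x - y‖ := fun k i x y => by
    simp only [hU, sub_sub_sub_cancel_right]; exact hlip k i x y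
  have hWlip : ∀ i x y, |W i x - W i y| ≤ K * ‖x - y‖ := fun i x y =>
    le_of_tendsto ((hW i x).sub (hW i y)).abs (Filter.Eventually.of_forall fun k => hUlip k i x y)
  have hWc : ∀ i, Continuous (W i) := fun i => cont_of_lip (hWlip i)
  have hUp : ∀ k i, TorusFun (U k i) := fun k i x z hz => by
    simp only [hU, hVp k i x z hz]
  have hUc : ∀ k i, Continuous (U k i) := fun k i => (hVc k i).sub continuous_const
  have hWp : ∀ i, TorusFun (W i) := fun i x z hz => by
    refine tendsto_nhds_unique (hW i (x + z)) ?_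
    simp only [hUp _ i x z hz]
    exact hW i x
  have hlimU : ∀ i (x : ℕ → Euc n) y, Tendsto x F (𝓝 y) →
      Tendsto (fun k => U k i (x k)) F (𝓝 (W i y)) := by
    intro i x y hx
    have h1 : Tendsto (fun k => U k i (x k) - U k i y) F (𝓝 0) := by
      have h2 : Tendsto (fun k => K * ‖x k - y‖) F (𝓝 0) := by
        have := (tendsto_iff_norm_sub_tendsto_zero.1 hx).const_mul K
        simpa using this
      exact squeeze_zero_norm (fun k => by rw [Real.norm_eq_abs]; exact hUlip k i (x k) y) h2
    have := h1.add (hW i y)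
    simpa using this
  have hlam_lim : Tendsto lam F (𝓝 0) :=
    tendsto_one_div_add_atTop_nhds_zero_nat.mono_left hF
  have hlimS : ∀ i (x : ℕ → Euc n) y, Tendsto x F (𝓝 y) →
      Tendsto (fun k => ∑ j, A k i j * V k j (x k)) F (𝓝 (c0 + ∑ j, B i j * W j y)) := by
    intro i x y hx
    have h1 : (fun k => ∑ j, A k i j * V k j (x k)) = fun k =>
        lam k * U k i (x k) + lam k * V k i0 0 + ∑ j, B i j * U k j (x k) := by
      funext k
      rw [hAsum k i (fun j => V k j (x k))]
      have : ∑ j, B i j * U k j (x k) = ∑ j, B i j * V k j (x k) - (∑ j, B i j) * V k i0 0 := by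
        rw [Finset.sum_mul, ← Finset.sum_sub_distrib]
        exact Finset.sum_congr rfl fun l _ => by simp only [hU]; ring
      rw [this, hrow i]
      simp only [hU]; ring
    rw [h1]
    have h2 := ((hlam_lim.mul (hlimU i x y hx)).add hc0).add
      (tendsto_finsetSum Finset.univ fun j _ => (hlimU j x y hx).const_mul (B i j))
    simpa using h2
  have hHlim : ∀ i (φ : Euc n → ℝ), ContDiff ℝ 1 φ → ∀ (x : ℕ → Euc n) y, Tendsto x F (𝓝 y) →
      Tendsto (fun k => H i (x k) (gradient φ (x k))) F (𝓝 (H i y (gradient φ y))) := by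
    intro i φ hφ x y hx
    have hcc : Continuous fun y : Euc n => H i y (gradient φ y) :=
      (hH.cont i).comp (continuous_id.prodMk (grad_cont hφ))
    exact (hcc.tendsto y).comp hx
  refine ⟨-c0, W, ⟨K, hK0, hWlip⟩, hWp, ?_, ?_⟩
  · intro i ψ hψ hψp x0 hx0
    obtain ⟨φ, hφ, hg⟩ := globalize (hWc i) (hWp i) hψ hψp hx0
    rw [← hg]
    obtain ⟨x, hx, hxm, -⟩ := touch_limit F (u := fun k => U k i) (fun k => hUc k i)
      (fun k => hUp k i) (hWc i) hφ (hW i x0) (fun x y hx ε hε => by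
        have h1 := (hlimU i x y hx).sub (((hWc i).tendsto y).comp hx)
        rw [sub_self] at h1
        filter_upwards [h1.eventually (gt_mem_nhds hε)] with k hk
        simp only [Function.comp] at hk
        linarith)
    have h2 : ∀ k, (∑ j, A k i j * V k j (x k)) + H i (x k) (gradient φ (x k)) ≤ 0 := by
      intro k
      refine hVsub k i φ hφ.1 hφ.2.1 (x k) ?_
      filter_upwards [hxm k] with y hy
      simp only [hU] at hy
      linarith
    have h3 := le_of_tendsto ((hlimS i x x0 hx).add (hHlim i φ hφ.1 x x0 hx))
      (Filter.Eventually.of_forall h2)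
    simp only
    linarith
  · intro i ψ hψ hψp x0 hx0
    have hloc' : IsLocalMax (fun y => (-W i y) - (-ψ y)) x0 := by
      filter_upwards [hx0] with y hy
      linarith
    obtain ⟨φ, hφ, hg⟩ := globalize (u := fun y => -W i y) (ψ := fun y => -ψ y)
      (hWc i).neg (fun x z hz => by simp only [hWp i x z hz]) hψ.neg
      (fun x z hz => by simp only [hψp x z hz]) hloc'
    rw [grad_neg'] at hg
    have hg' : gradient ψ x0 = gradient (fun y => -φ y) x0 := by
      rw [grad_neg', hg, neg_neg]
    rw [hg']
    obtain ⟨x, hx, hxm, -⟩ := touch_limit F (u := fun k y => -U k i y) (v := fun y => -W i y) (fun k => (hUc k i).neg)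
      (fun k x z hz => by simp only [hUp k i x z hz]) (hWc i).neg hφ (hW i x0).neg
      (fun x y hx ε hε => by
        have h1 := (((hWc i).tendsto y).comp hx).sub (hlimU i x y hx)
        rw [sub_self] at h1
        filter_upwards [h1.eventually (gt_mem_nhds hε)] with k hk
        simp only [Function.comp] at hk
        linarith)
    have hφn : ContDiff ℝ 1 (fun y => -φ y) := hφ.1.neg
    have h2 : ∀ k, 0 ≤ (∑ j, A k i j * V k j (x k)) +
        H i (x k) (gradient (fun y => -φ y) (x k)) := by
      intro k
      refine hVsup k i _ hφn (fun x z hz => by simp only [hφ.2.1 x z hz]) (x k) ?_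
      filter_upwards [hxm k] with y hy
      simp only [hU] at hy
      linarith
    have h3 := ge_of_tendsto ((hlimS i x x0 hx).add (hHlim i _ hφn x x0 hx))
      (Filter.Eventually.of_forall h2)
    simp only
    linarith

lemma ham_good {n m : ℕ} {Ξ : Type*} [MetricSpace Ξ] [CompactSpace Ξ]
    (g : Fin m → Euc n × Ξ → Euc n) (L : Fin m → Euc n × Ξ → ℝ)
    (hgL : GoodData g L) (hcoer : Coercive g L) : GoodH (fun i => ham g L i) where
  cont i := by
    have h1 := (hgL.1 i).1
    have h2 := (hgL.2 i).1
    have h3 : Continuous (Function.uncurry fun (q : Euc n × Euc n) (ξ : Ξ) =>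
        -⟪g i (q.1, ξ), q.2⟫ - L i (q.1, ξ)) := by
      unfold Function.uncurry
      fun_prop
    have h4 := (isCompact_univ (X := Ξ)).continuous_sSup
      (f := fun (q : Euc n × Euc n) (ξ : Ξ) => -⟪g i (q.1, ξ), q.2⟫ - L i (q.1, ξ)) h3
    simp only [Set.image_univ] at h4
    exact h4
  per i x z p hz := by
    simp only [ham, (hgL.1 i).2 x z _ hz, (hgL.2 i).2 x z _ hz]
  coer i M := hcoer i M

lemma sol_of {n m : ℕ} {Ξ : Type*}
    {g : Fin m → Euc n × Ξ → Euc n} {L : Fin m → Euc n × Ξ → ℝ}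
    {B : Matrix (Fin m) (Fin m) ℝ} {c : ℝ} {v : Fin m → Euc n → ℝ}
    (hl : ∃ K > 0, ∀ i x y, |v i x - v i y| ≤ K * ‖x - y‖) (hp : ∀ i, TorusFun (v i))
    (h1 : SubV B (fun i x p => ham g L i x p - c) v)
    (h2 : SuperV B (fun i x p => ham g L i x p - c) v) :
    ∃ (c : Fin m → ℝ) (v : Fin m → Euc n → ℝ),
      (∀ i, ∃ K : NNReal, LipschitzWith K (v i)) ∧
      IsSol (fun _ => B) 0 g L c v := by
  obtain ⟨K, hK0, hK⟩ := hl
  have hc : ∀ i, Continuous (v i) := fun i => cont_of_lip (hK i)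
  refine ⟨fun _ => c, v, fun i => ⟨⟨K, hK0.le⟩, LipschitzWith.of_dist_le_mul fun x y => ?_⟩,
    hc, ⟨fun i => ⟨(hc i).upperSemicontinuous, hp i⟩, ?_⟩,
    ⟨fun i => ⟨(hc i).lowerSemicontinuous, hp i⟩, ?_⟩⟩
  · rw [Real.dist_eq, dist_eq_norm]; exact hK i x y
  · intro i ψ hψ hψp x hx
    have := h1 i ψ hψ hψp x hx
    simp only at this
    linarith
  · intro i ψ hψ hψp x hx
    have := h2 i ψ hψ hψp x hx
    simp only at this
    linarith

theorem stmt18 {n m : ℕ} (hn : 0 < n) (hm : 0 < m)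
    {Ξ : Type*} [MetricSpace Ξ] [CompactSpace Ξ] [Nonempty Ξ]
    (g : Fin m → Euc n × Ξ → Euc n) (L : Fin m → Euc n × Ξ → ℝ)
    (hgL : GoodData g L) (hcoer : Coercive g L)
    (B : Matrix (Fin m) (Fin m) ℝ) (hB : IsMonotoneMat B)
    (hirr : ∀ I : Set (Fin m), I.Nonempty → I ≠ Set.univ →
      ∃ i ∈ I, ∃ j ∉ I, B i j ≠ 0) :
    ∃ (c : Fin m → ℝ) (v : Fin m → Euc n → ℝ),
      (∀ i, ∃ K : NNReal, LipschitzWith K (v i)) ∧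
      IsSol (fun _ => B) 0 g L c v := by
  have hH := ham_good g L hgL hcoer
  by_cases hrow : ∀ i, ∑ j, B i j = 0
  · obtain ⟨c, v, hl, hp, h1, h2⟩ := discount hm (mono_offdiag hB) hirr hrow hH
    exact sol_of hl hp h1 h2
  · push Not at hrow
    obtain ⟨i0, hi0⟩ := hrow
    obtain ⟨s, hs0, hs⟩ := exists_s hB hirr (lt_of_le_of_ne (mono_rowsum hB i0) hi0.symm)
    obtain ⟨C, hC0, hC⟩ := hH.bdd0
    obtain ⟨v, hl, hp, h1, h2, -⟩ := perron hH (mono_offdiag hB) hs0 (t := C + 1) (by linarith) hC0 hC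
      (fun i => by rw [hs i]; linarith)
    refine sol_of (c := 0) hl hp ?_ ?_
    · simpa using h1
    · simpa using h2
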